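/- arXiv:1810.01189 — 7 statements merged into one kernel-verified Lean document; each statement's English description precedes it below -/
import Mathlib

section
/- If G is a connected simple graph on n ≥ 2 vertices whose minimum degree δ(G) satisfies δ(G) ≥ n/2, then κ'(G) = δ(G). -/
open Finset

/-- Number of edges of `G` with exactly one endpoint in `S`, counted as ordered pairs
`(u, v)` with `u ∈ S`, `v ∉ S`, `G.Adj u v`. -/
noncomputable def cutCard {V : Type*} [Fintype V] (G : SimpleGraph V) (S : Finset V) : ℕ := by
  classical
  exact (Finset.univ.filter (fun p : V × V => p.1 ∈ S ∧ p.2 ∉ S ∧ G.Adj p.1 p.2)).card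

/-- The edge-connectivity of a finite graph: the minimum of `cutCard G S` over nonempty
proper vertex subsets `S`. -/
noncomputable def edgeConn {V : Type*} [Fintype V] (G : SimpleGraph V) : ℕ :=
  sInf {k | ∃ S : Finset V, S.Nonempty ∧ S ≠ Finset.univ ∧ cutCard G S = k}

theorem cutCard_eq_sum {V : Type*} [Fintype V] [DecidableEq V] (G : SimpleGraph V)
    [DecidableRel G.Adj] (S : Finset V) :
    cutCard G S = ∑ u ∈ S, #(G.neighborFinset u \ S) := by
  classical
  rw [← Finset.card_sigma]
  unfold cutCard
  refine Finset.card_nbij' (fun p => ⟨p.1, p.2⟩) (fun p => (p.1, p.2)) ?_ ?_ ?_ ?_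
  · rintro ⟨u, v⟩
    simp +contextual
  · rintro ⟨u, v⟩
    simp +contextual
  · intro p _
    rfl
  · intro p _
    rfl

theorem cutCard_compl {V : Type*} [Fintype V] [DecidableEq V] (G : SimpleGraph V)
    (S : Finset V) : cutCard G Sᶜ = cutCard G S := by
  classical
  unfold cutCard
  refine Finset.card_nbij' Prod.swap Prod.swap ?_ ?_ ?_ ?_
  · rintro ⟨u, v⟩
    simp +contextual [G.adj_comm]
  · rintro ⟨u, v⟩
    simp +contextual [G.adj_comm]
  · intro p _
    rfl
  · intro p _
    rfl

theorem cutCard_singleton {V : Type*} [Fintype V] (G : SimpleGraph V)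
    [DecidableRel G.Adj] (v : V) : cutCard G {v} = G.degree v := by
  classical
  rw [cutCard_eq_sum, sum_singleton, sdiff_singleton_eq_erase, erase_eq_of_notMem (by simp),
    SimpleGraph.card_neighborFinset_eq_degree]

/-- A nonempty vertex set with at most `δ(G)` elements is left by at least `δ(G)` edges. -/
theorem minDegree_le_cutCard {V : Type*} [Fintype V] (G : SimpleGraph V)
    [DecidableRel G.Adj] {S : Finset V} (hS : S.Nonempty) (hcard : #S ≤ G.minDegree) :
    G.minDegree ≤ cutCard G S := by
  classical
  have houtside : ∀ u ∈ S, G.minDegree + 1 - #S ≤ #(G.neighborFinset u \ S) := by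
    intro u hu
    have hsub : G.neighborFinset u ⊆ (G.neighborFinset u \ S) ∪ S.erase u := by
      intro w hw
      have hne : w ≠ u := by
        rintro rfl
        simp at hw
      by_cases hwS : w ∈ S <;> simp_all
    have hle := (card_le_card hsub).trans (card_union_le _ _)
    rw [card_erase_of_mem hu, SimpleGraph.card_neighborFinset_eq_degree] at hle
    have := G.minDegree_le_degree u
    have := hS.card_pos
    omega
  rw [cutCard_eq_sum]
  refine le_trans ?_ (card_nsmul_le_sum S _ _ houtside)
  obtain ⟨a, ha⟩ := Nat.exists_eq_add_of_le hcard
  obtain ⟨b, hb⟩ := Nat.exists_eq_add_of_le hS.card_pos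
  have hsub : G.minDegree + 1 - #S = a + 1 := by omega
  rw [hsub, smul_eq_mul, ha, hb]
  nlinarith [Nat.zero_le (a * b)]

theorem stmt2 {V : Type*} [Fintype V] (G : SimpleGraph V) [DecidableRel G.Adj]
    (hn : 2 ≤ Fintype.card V) (hconn : G.Connected)
    (hdeg : (Fintype.card V : ℝ) / 2 ≤ G.minDegree) :
    edgeConn G = G.minDegree := by
  classical
  have hdeg' : Fintype.card V ≤ 2 * G.minDegree := by
    have : (Fintype.card V : ℝ) ≤ 2 * G.minDegree := by linarith
    exact_mod_cast this
  have := hconn.nonempty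
  obtain ⟨v, hv⟩ := G.exists_minimal_degree_vertex
  have hproper : ({v} : Finset V) ≠ univ := by
    intro h
    have := congrArg card h
    rw [card_singleton, card_univ] at this
    omega
  have hmem : G.minDegree ∈
      {k | ∃ S : Finset V, S.Nonempty ∧ S ≠ Finset.univ ∧ cutCard G S = k} :=
    ⟨{v}, singleton_nonempty v, hproper, by rw [cutCard_singleton, hv]⟩
  refine le_antisymm (Nat.sInf_le hmem) (le_csInf ⟨_, hmem⟩ ?_)
  rintro _ ⟨S, hS, hSu, rfl⟩
  by_cases hcard : #S ≤ G.minDegree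
  · exact minDegree_le_cutCard G hS hcard
  · rw [← cutCard_compl]
    refine minDegree_le_cutCard G ?_ ?_
    · rwa [nonempty_iff_ne_empty, Ne, compl_eq_empty_iff]
    · rw [card_compl]
      omega
end

section
/- Let n ≥ 1 and let A be a real (n+1)×(n+1) tridiagonal matrix with nonnegative entries, with diagonal entries a₀, a₁, …, aₙ, superdiagonal entries b₀, b₁, …, b_{n−1}, and subdiagonal entries c₁, c₂, …, cₙ, such that every row sum of A equals d (so a₀ + b₀ = d, cᵢ + aᵢ + bᵢ = d for 1 ≤ i ≤ n−1, and cₙ + aₙ = d). Let Ã be the n×n tridiagonal matrix with diagonal entries d − b_{k−1} − c_k for k = 1, …, n (where c_{n} is the last subdiagonal entry of A, and b_{k}, c_{k} are as in A), superdiagonal entries b₁, …, b_{n−1}, and subdiagonal entries c₁, …, c_{n−1}. Then the characteristic polynomial of A equals (x − d) times the characteristic polynomial of Ã; equivalently, the multiset of eigenvalues of A is {d} together with the multiset of eigenvalues of Ã, and d is the largest eigenvalue of A. -/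
open Polynomial

namespace TridiagonalReduction

/-- The entries of a matrix, extended by zero to all pairs of natural numbers. -/
noncomputable def entry {n : ℕ} (M : Matrix (Fin n) (Fin n) ℝ) (i j : ℕ) : ℝ :=
  if h : i < n ∧ j < n then M ⟨i, h.1⟩ ⟨j, h.2⟩ else 0

lemma entry_coe {n : ℕ} (M : Matrix (Fin n) (Fin n) ℝ) (i j : Fin n) :
    entry M i j = M i j := by
  simp [entry]

lemma entry_of_le_right {n : ℕ} (M : Matrix (Fin n) (Fin n) ℝ) (i : ℕ) {j : ℕ} (h : n ≤ j) :
    entry M i j = 0 :=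
  dif_neg (by omega)

lemma entry_eq_zero {n : ℕ} {M : Matrix (Fin n) (Fin n) ℝ}
    (hM : ∀ i j : Fin n, ((i : ℕ) + 1 < (j : ℕ) ∨ (j : ℕ) + 1 < (i : ℕ)) → M i j = 0)
    {i j : ℕ} (h : i + 1 < j ∨ j + 1 < i) : entry M i j = 0 := by
  unfold entry
  split_ifs
  · exact hM _ _ h
  · rfl

/-- The row sum of a tridiagonal matrix, written through the three central entries. -/
lemma tridiagonal_row_sum {n : ℕ} {M : Matrix (Fin n) (Fin n) ℝ}
    (hM : ∀ i j : Fin n, ((i : ℕ) + 1 < (j : ℕ) ∨ (j : ℕ) + 1 < (i : ℕ)) → M i j = 0)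
    (i : Fin n) :
    ∑ j, M i j = (if (i : ℕ) = 0 then 0 else entry M i (i - 1)) + entry M i i
      + entry M i (i + 1) := by
  have hsum : ∑ j, M i j = ∑ j ∈ Finset.range (i + 2), entry M i j := by
    have h1 : ∑ j, M i j = ∑ j ∈ Finset.range n, entry M i j := by
      rw [← Fin.sum_univ_eq_sum_range]
      simp only [entry_coe]
    have h2 : ∑ j ∈ Finset.range n, entry M i j = ∑ j ∈ Finset.range (n + 2), entry M i j := by
      refine Finset.sum_subset (fun j => by simp; omega) fun j _ hj => ?_
      exact entry_of_le_right M _ (by simpa using hj)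
    rw [h1, h2]
    refine (Finset.sum_subset (fun j => by simp; omega) fun j _ hj => ?_).symm
    exact entry_eq_zero hM (by simp at hj; omega)
  rw [hsum, Finset.sum_range_succ, Finset.sum_range_succ]
  congr 2
  split_ifs with h
  · simp [h]
  · obtain ⟨k, hk⟩ := Nat.exists_eq_succ_of_ne_zero h
    simp only [hk, Nat.succ_eq_add_one, Nat.add_sub_cancel]
    rw [Finset.sum_range_succ, Finset.sum_eq_zero, zero_add]
    intro j hj
    exact entry_eq_zero hM (by simp at hj; omega)

/-- The change of basis sending `f` to `(f 0, f 1 - f 0, …, f n - f (n - 1))`. -/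
def diffMatrix (n : ℕ) : Matrix (Fin (n + 1)) (Fin (n + 1)) ℝ :=
  Matrix.of fun i j => (if i = j then 1 else 0) - (if (i : ℕ) = j + 1 then 1 else 0)

lemma det_diffMatrix (n : ℕ) : (diffMatrix n).det = 1 := by
  rw [Matrix.det_of_isLowerTriangular]
  · simp [diffMatrix]
  · intro i j hij
    have hlt : i < j := by simpa using hij
    have h1 : (i : ℕ) ≠ j + 1 := by have := Fin.lt_def.1 hlt; omega
    simp [diffMatrix, hlt.ne, h1]

lemma diffMatrix_mul_zero (n : ℕ) (M : Matrix (Fin (n + 1)) (Fin (n + 1)) ℝ) (j : Fin (n + 1)) :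
    (diffMatrix n * M) 0 j = M 0 j := by
  simp [Matrix.mul_apply, diffMatrix]

lemma diffMatrix_mul_succ (n : ℕ) (M : Matrix (Fin (n + 1)) (Fin (n + 1)) ℝ)
    (i : Fin n) (j : Fin (n + 1)) :
    (diffMatrix n * M) i.succ j = M i.succ j - M i.castSucc j := by
  have h (k : Fin (n + 1)) : (i : ℕ) = k ↔ i.castSucc = k := by simp [Fin.ext_iff]
  simp [Matrix.mul_apply, diffMatrix, sub_mul, h]

lemma mul_diffMatrix (n : ℕ) (M : Matrix (Fin (n + 1)) (Fin (n + 1)) ℝ) (i j : Fin (n + 1)) :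
    (M * diffMatrix n) i j = M i j - entry M i (j + 1) := by
  simp only [Matrix.mul_apply, diffMatrix, Matrix.of_apply, mul_sub, Finset.sum_sub_distrib]
  congr 1
  · simp
  · by_cases h : (j : ℕ) + 1 < n + 1
    · have h' (k : Fin (n + 1)) : (k : ℕ) = j + 1 ↔ k = ⟨j + 1, h⟩ := by simp [Fin.ext_iff]
      simp only [h']
      simp [entry, h]
      intro hn
      omega
    · rw [entry_of_le_right M _ (not_lt.1 h)]
      refine Finset.sum_eq_zero fun k _ => ?_
      rw [if_neg (by omega), mul_zero]

/-- The block upper triangular matrix with diagonal blocks `d` and `M`, and top row `r`. -/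
def bordered {n : ℕ} (d : ℝ) (r : Fin n → ℝ) (M : Matrix (Fin n) (Fin n) ℝ) :
    Matrix (Fin (n + 1)) (Fin (n + 1)) ℝ :=
  Matrix.of (Fin.cons (Fin.cons d r : Fin (n + 1) → ℝ)
    fun i => (Fin.cons 0 (M i) : Fin (n + 1) → ℝ))

lemma charpoly_bordered {n : ℕ} (d : ℝ) (r : Fin n → ℝ) (M : Matrix (Fin n) (Fin n) ℝ) :
    (bordered d r M).charpoly = (X - C d) * M.charpoly := by
  have hsub : (bordered d r M).charmatrix.submatrix Fin.succ Fin.succ = M.charmatrix := by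
    ext1 i j
    simp [Matrix.charmatrix_apply, bordered, Matrix.diagonal_apply]
  rw [Matrix.charpoly, Matrix.det_succ_column_zero, Fin.sum_univ_succ, Finset.sum_eq_zero]
  · have h0 : (bordered d r M).charmatrix 0 0 = X - C d := by
      simp [bordered]
    simp only [Fin.succAbove_zero, hsub, h0]
    simp [Matrix.charpoly]
  · intro i _
    simp [bordered]

lemma bordered_zero_succ {n : ℕ} (d : ℝ) (r : Fin n → ℝ) (M : Matrix (Fin n) (Fin n) ℝ)
    (j : Fin n) : bordered d r M 0 j.succ = r j := rfl

lemma bordered_succ_zero {n : ℕ} (d : ℝ) (r : Fin n → ℝ) (M : Matrix (Fin n) (Fin n) ℝ)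
    (i : Fin n) : bordered d r M i.succ 0 = 0 := rfl

lemma bordered_succ_succ {n : ℕ} (d : ℝ) (r : Fin n → ℝ) (M : Matrix (Fin n) (Fin n) ℝ)
    (i j : Fin n) : bordered d r M i.succ j.succ = M i j := rfl

lemma entry_bordered_succ {n : ℕ} (d : ℝ) (r : Fin n → ℝ) (M : Matrix (Fin n) (Fin n) ℝ)
    (i j : ℕ) : entry (bordered d r M) (i + 1) (j + 1) = entry M i j := by
  unfold entry
  by_cases h : i < n ∧ j < n
  · rw [dif_pos h, dif_pos (by omega)]
    rfl
  · rw [dif_neg h, dif_neg (by omega)]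

lemma charpoly_eq_of_mul_eq {m : Type*} [Fintype m] [DecidableEq m] {P A B : Matrix m m ℝ}
    (hP : IsUnit P) (h : P * A = B * P) : A.charpoly = B.charpoly := by
  obtain ⟨u, rfl⟩ := hP
  have hB : B = u.val * A * u⁻¹.val := by rw [h, mul_assoc, Units.mul_inv, mul_one]
  rw [hB]
  simp

/-- By Gershgorin, the real eigenvalues of a nonnegative matrix with constant row sums are bounded
by the row sum. -/
lemma isRoot_charpoly_le {m : Type*} [Fintype m] [DecidableEq m] {A : Matrix m m ℝ} {d x : ℝ}
    (hnonneg : ∀ i j, 0 ≤ A i j) (hrow : ∀ i, ∑ j, A i j = d) (hx : A.charpoly.IsRoot x) :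
    x ≤ d := by
  have hev : Module.End.HasEigenvalue (Matrix.toLin' A) x := by
    rw [Module.End.hasEigenvalue_iff_isRoot_charpoly]
    simpa using hx
  obtain ⟨k, hk⟩ := eigenvalue_mem_ball hev
  rw [Metric.mem_closedBall, Real.dist_eq] at hk
  simp only [Real.norm_of_nonneg (hnonneg _ _)] at hk
  have h1 := Finset.add_sum_erase Finset.univ (A k) (Finset.mem_univ k)
  have h2 := le_abs_self (x - A k k)
  linarith [hrow k]

lemma diffMatrix_intertwines {n : ℕ} {d : ℝ} {A : Matrix (Fin (n + 1)) (Fin (n + 1)) ℝ}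
    (htriA : ∀ i j : Fin (n + 1),
      ((i : ℕ) + 1 < (j : ℕ) ∨ (j : ℕ) + 1 < (i : ℕ)) → A i j = 0)
    (hrow : ∀ i, ∑ j, A i j = d) {Atil : Matrix (Fin n) (Fin n) ℝ}
    (hdiag : ∀ i : Fin n, Atil i i = d - A i.castSucc i.succ - A i.succ i.castSucc)
    (hsuper : ∀ i j : Fin n, (j : ℕ) = (i : ℕ) + 1 → Atil i j = A j.castSucc j.succ)
    (hsub : ∀ i j : Fin n, (i : ℕ) = (j : ℕ) + 1 → Atil i j = A j.succ j.castSucc)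
    (htriAtil : ∀ i j : Fin n,
      ((i : ℕ) + 1 < (j : ℕ) ∨ (j : ℕ) + 1 < (i : ℕ)) → Atil i j = 0) :
    diffMatrix n * A = bordered d (fun j => A 0 j.succ) Atil * diffMatrix n := by
  have hrow' (i : ℕ) (hi : i < n + 1) :
      (if i = 0 then 0 else entry A i (i - 1)) + entry A i i + entry A i (i + 1) = d := by
    rw [← hrow ⟨i, hi⟩, tridiagonal_row_sum htriA]
  have hdiag' (i : ℕ) (hi : i < n) :
      entry Atil i i = d - entry A i (i + 1) - entry A (i + 1) i := by
    have := hdiag ⟨i, hi⟩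
    simpa only [← entry_coe, Fin.val_castSucc, Fin.val_succ] using this
  have hsuper' (i : ℕ) : entry Atil i (i + 1) = entry A (i + 1) (i + 2) := by
    by_cases hi : i + 1 < n
    · have := hsuper ⟨i, by omega⟩ ⟨i + 1, hi⟩ rfl
      simpa only [← entry_coe, Fin.val_castSucc, Fin.val_succ] using this
    · rw [entry_of_le_right _ _ (by omega), entry_of_le_right _ _ (by omega)]
  have hsub' (i : ℕ) (hi : i + 1 < n) : entry Atil (i + 1) i = entry A (i + 1) i := by
    have := hsub ⟨i + 1, hi⟩ ⟨i, by omega⟩ rfl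
    simpa only [← entry_coe, Fin.val_castSucc, Fin.val_succ] using this
  ext i j
  rw [mul_diffMatrix]
  induction i using Fin.cases with
  | zero =>
    rw [diffMatrix_mul_zero]
    have hr (k : ℕ) : entry (bordered d (fun j => A 0 j.succ) Atil) 0 (k + 1)
        = entry A 0 (k + 1) := by
      unfold entry
      split_ifs
      · rfl
      · rfl
    induction j using Fin.cases with
    | zero =>
      have h0 := hrow' 0 (by omega)
      have h1 := entry_coe A 0 0
      simp only [Fin.val_zero, hr]
      simp only [Fin.val_zero] at h1
      simp only [if_true] at h0
      simp only [bordered, Matrix.of_apply, Fin.cons_zero]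
      linarith
    | succ j =>
      rw [bordered_zero_succ, Fin.val_zero, hr, entry_eq_zero htriA (by simp), sub_zero]
  | succ i =>
    rw [diffMatrix_mul_succ, Fin.val_succ, entry_bordered_succ]
    rw [← entry_coe A i.succ j, ← entry_coe A i.castSucc j]
    simp only [Fin.val_castSucc, Fin.val_succ]
    have hi := i.isLt
    have e1 := hdiag' i hi
    induction j using Fin.cases with
    | zero =>
      rw [bordered_succ_zero]
      simp only [Fin.val_zero]
      generalize (i : ℕ) = k at *
      match k with
      | 0 =>
        have h0 := hrow' 0 (by omega)
        simp only [if_true] at h0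
        linarith
      | 1 =>
        have := hsub' 0 hi
        have h2 := entry_eq_zero htriA (i := 2) (j := 0) (by omega)
        simp only [zero_add] at *
        norm_num
        linarith
      | k + 2 =>
        rw [entry_eq_zero htriA (by omega), entry_eq_zero htriA (by omega),
          entry_eq_zero htriAtil (by omega)]
    | succ j =>
      rw [bordered_succ_succ, ← entry_coe Atil, Fin.val_succ]
      generalize (i : ℕ) = k at *
      have hj := j.isLt
      generalize (j : ℕ) = l at *
      rcases lt_trichotomy l k with h | rfl | h
      · rcases Nat.lt_or_ge (l + 1) k with h' | h'
        · rcases Nat.lt_or_ge (l + 2) k with h'' | h''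
          · rw [entry_eq_zero htriA (by omega), entry_eq_zero htriA (by omega),
              entry_eq_zero htriAtil (by omega), entry_eq_zero htriAtil (by omega)]
          · obtain rfl : k = l + 2 := by omega
            rw [entry_eq_zero htriA (by omega), hsub' (l + 1) hi,
              entry_eq_zero htriAtil (i := l + 2) (j := l) (by omega)]
        · obtain rfl : k = l + 1 := by omega
          have h3 := hrow' (l + 1) (by omega)
          rw [if_neg (by omega), Nat.add_sub_cancel] at h3
          have h4 := hsub' l hi
          linarith
      · have h3 := hrow' (l + 1) (by omega)
        rw [if_neg (by omega), Nat.add_sub_cancel] at h3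
        have h4 := hsuper' l
        linarith
      · rcases Nat.lt_or_ge (k + 1) l with h' | h'
        · rw [entry_eq_zero htriA (by omega), entry_eq_zero htriA (by omega),
            entry_eq_zero htriAtil (by omega), entry_eq_zero htriAtil (by omega)]
        · obtain rfl : l = k + 1 := by omega
          rw [hsuper', entry_eq_zero htriA (i := k) (by omega),
            entry_eq_zero htriAtil (i := k) (by omega)]

end TridiagonalReduction

theorem stmt10 (n : ℕ) (hn : 1 ≤ n) (d : ℝ)
    (A : Matrix (Fin (n + 1)) (Fin (n + 1)) ℝ)
    (hnonneg : ∀ i j, 0 ≤ A i j)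
    (htriA : ∀ i j : Fin (n + 1), ((i : ℕ) + 1 < (j : ℕ) ∨ (j : ℕ) + 1 < (i : ℕ)) → A i j = 0)
    (hrow : ∀ i, ∑ j, A i j = d)
    (Atil : Matrix (Fin n) (Fin n) ℝ)
    -- diagonal of `Ã`: `d - b_{k-1} - c_k`, i.e. `d - A (k-1) k - A k (k-1)` for `k = 1, …, n`
    (hdiag : ∀ i : Fin n, Atil i i = d - A i.castSucc i.succ - A i.succ i.castSucc)
    -- superdiagonal of `Ã`: `b₁, …, b_{n-1}`
    (hsuper : ∀ i j : Fin n, (j : ℕ) = (i : ℕ) + 1 → Atil i j = A j.castSucc j.succ)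
    -- subdiagonal of `Ã`: `c₁, …, c_{n-1}`
    (hsub : ∀ i j : Fin n, (i : ℕ) = (j : ℕ) + 1 → Atil i j = A j.succ j.castSucc)
    (htriAtil : ∀ i j : Fin n, ((i : ℕ) + 1 < (j : ℕ) ∨ (j : ℕ) + 1 < (i : ℕ)) → Atil i j = 0) :
    A.charpoly = (X - C d) * Atil.charpoly ∧
      (∀ x : ℝ, A.charpoly.IsRoot x → x ≤ d) ∧ A.charpoly.IsRoot d := by
  have hchar : A.charpoly = (X - C d) * Atil.charpoly := by
    have hunit : IsUnit (TridiagonalReduction.diffMatrix n) := by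
      rw [Matrix.isUnit_iff_isUnit_det, TridiagonalReduction.det_diffMatrix]
      exact isUnit_one
    rw [← TridiagonalReduction.charpoly_bordered d (fun j => A 0 j.succ) Atil]
    exact TridiagonalReduction.charpoly_eq_of_mul_eq hunit
      (TridiagonalReduction.diffMatrix_intertwines htriA hrow hdiag hsuper hsub htriAtil)
  refine ⟨hchar, fun x hx => TridiagonalReduction.isRoot_charpoly_le hnonneg hrow hx, ?_⟩
  simp [hchar]
end

section
/- Let d and t be integers with 3 ≤ t ≤ d−1. Then d − 2(t−1)/(d+1) > (d − 3 + √((d+3)² − 8t))/2. -/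
theorem stmt12 (d t : ℤ) (ht3 : 3 ≤ t) (htd : t ≤ d - 1) :
    ((d : ℝ) - 3 + Real.sqrt (((d : ℝ) + 3) ^ 2 - 8 * t)) / 2
      < (d : ℝ) - 2 * ((t : ℝ) - 1) / ((d : ℝ) + 1) := by
  have h3 : (3 : ℝ) ≤ t := by exact_mod_cast ht3
  have hd : (t : ℝ) ≤ d - 1 := by exact_mod_cast htd
  generalize (d : ℝ) = x at *
  generalize (t : ℝ) = y at *
  have hx : 0 < x + 1 := by linarith
  obtain ⟨u, hu⟩ : ∃ u, u = (y - 1) / (x + 1) := ⟨_, rfl⟩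
  have hy : y = u * (x + 1) + 1 := by rw [hu]; field_simp; ring
  have hu0 : 0 < u := hu ▸ div_pos (by linarith) hx
  have hu1 : u < 1 := hu ▸ (div_lt_one hx).2 (by linarith)
  have key : Real.sqrt ((x + 3) ^ 2 - 8 * y) < x + 3 - 4 * u := by
    rw [Real.sqrt_lt' (by linarith), hy]
    nlinarith [sq_nonneg (1 - u), pow_pos hu0 2]
  rw [mul_div_assoc, ← hu]
  linarith
end

section
/- Let d and t be integers with 3 ≤ t ≤ d−1, and let α and β be real numbers with 1 ≤ α ≤ t and 1 ≤ β ≤ t. Define F(x) = (d − 1 − t/x − t/β + √((d − 1 − t/x − t/β)² + 4(d + dt/x + dt/β − 2t)))/2. Then F(α+1) ≤ F(α); that is, F is non-increasing as α increases by 1 (and by symmetry the same holds in β). -/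
theorem sqrt_sq_sub_add_le {p q c : ℝ} (hp : 0 ≤ p) (hpq : p ≤ q) (hc : 0 ≤ c)
    (hcp : c ≤ p ^ 2) : √(p ^ 2 - c) + (q - p) ≤ √(q ^ 2 - c) := by
  have hle : √(p ^ 2 - c) ≤ p := Real.sqrt_le_iff.mpr ⟨hp, by linarith⟩
  have hsq : √(p ^ 2 - c) ^ 2 = p ^ 2 - c := Real.sq_sqrt (by linarith)
  apply Real.le_sqrt_of_sq_le
  nlinarith [mul_le_mul_of_nonneg_left hle (sub_nonneg.mpr hpq)]

theorem stmt13 (d t : ℤ) (ht3 : 3 ≤ t) (htd : t ≤ d - 1)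
    (α β : ℝ) (hα1 : 1 ≤ α) (hαt : α ≤ (t : ℝ)) (hβ1 : 1 ≤ β) (hβt : β ≤ (t : ℝ)) :
    (fun x : ℝ =>
        ((d : ℝ) - 1 - (t : ℝ) / x - (t : ℝ) / β +
            Real.sqrt (((d : ℝ) - 1 - (t : ℝ) / x - (t : ℝ) / β) ^ 2 +
              4 * ((d : ℝ) + (d : ℝ) * (t : ℝ) / x + (d : ℝ) * (t : ℝ) / β - 2 * (t : ℝ)))) / 2)
        (α + 1)
      ≤ (fun x : ℝ =>
        ((d : ℝ) - 1 - (t : ℝ) / x - (t : ℝ) / β +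
            Real.sqrt (((d : ℝ) - 1 - (t : ℝ) / x - (t : ℝ) / β) ^ 2 +
              4 * ((d : ℝ) + (d : ℝ) * (t : ℝ) / x + (d : ℝ) * (t : ℝ) / β - 2 * (t : ℝ)))) / 2)
        α := by
  have ht : (3 : ℝ) ≤ t := by exact_mod_cast ht3
  have hd : (t : ℝ) ≤ d - 1 := by exact_mod_cast htd
  have hα : (t : ℝ) / (α + 1) ≤ t / α :=
    div_le_div_of_nonneg_left (by linarith) (by linarith) (by linarith)
  have hα0 : 0 ≤ (t : ℝ) / (α + 1) := div_nonneg (by linarith) (by linarith)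
  have hβ0 : 0 ≤ (t : ℝ) / β := div_nonneg (by linarith) (by linarith)
  have discr_eq (x : ℝ) :
      ((d : ℝ) - 1 - t / x - t / β) ^ 2 + 4 * (d + d * t / x + d * t / β - 2 * t) =
        (d + 1 + t / x + t / β) ^ 2 - 8 * t := by
    ring
  have key := sqrt_sq_sub_add_le (p := d + 1 + t / (α + 1) + t / β)
    (q := d + 1 + t / α + t / β) (c := 8 * t) (by linarith) (by linarith) (by linarith)
    (by nlinarith [sq_nonneg ((t : ℝ) - 2)])
  simp only [discr_eq]
  linarith
end

section
/- Let d and t be integers with 3 ≤ t ≤ d−1, and let α and β be real numbers with 1 ≤ α ≤ t and 1 ≤ β ≤ t. Define F(x) = (d − 2 − t/x − t/β + √((d − 2 − t/x − t/β)² + 4(2d + dt/x + dt/β − 2t)))/2. Then F(α+1) ≤ F(α); that is, F is non-increasing as α increases by 1 (and by symmetry the same holds in β). -/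
/-- On the domain `c ≤ u ^ 2`, the map `u ↦ √(u ^ 2 - c) - u` is non-decreasing. -/
theorem sqrt_sq_sub_add_sub_le {u v c : ℝ} (hu : 0 ≤ u) (huv : u ≤ v) (hc : 0 ≤ c)
    (hcu : c ≤ u ^ 2) : √(u ^ 2 - c) + (v - u) ≤ √(v ^ 2 - c) := by
  have hle : √(u ^ 2 - c) ≤ u := Real.sqrt_le_iff.mpr ⟨hu, by linarith⟩
  have hsq : √(u ^ 2 - c) ^ 2 = u ^ 2 - c := Real.sq_sqrt (by linarith)
  apply Real.le_sqrt_of_sq_le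
  nlinarith [mul_le_mul_of_nonneg_left hle (sub_nonneg.mpr huv)]

theorem stmt14 (d t : ℤ) (ht3 : 3 ≤ t) (htd : t ≤ d - 1)
    (α β : ℝ) (hα1 : 1 ≤ α) (hαt : α ≤ (t : ℝ)) (hβ1 : 1 ≤ β) (hβt : β ≤ (t : ℝ)) :
    (fun x : ℝ =>
        ((d : ℝ) - 2 - (t : ℝ) / x - (t : ℝ) / β +
            Real.sqrt (((d : ℝ) - 2 - (t : ℝ) / x - (t : ℝ) / β) ^ 2 +
              4 * (2 * (d : ℝ) + (d : ℝ) * (t : ℝ) / x + (d : ℝ) * (t : ℝ) / β - 2 * (t : ℝ)))) / 2)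
        (α + 1)
      ≤ (fun x : ℝ =>
        ((d : ℝ) - 2 - (t : ℝ) / x - (t : ℝ) / β +
            Real.sqrt (((d : ℝ) - 2 - (t : ℝ) / x - (t : ℝ) / β) ^ 2 +
              4 * (2 * (d : ℝ) + (d : ℝ) * (t : ℝ) / x + (d : ℝ) * (t : ℝ) / β - 2 * (t : ℝ)))) / 2)
        α := by
  have ht : (3 : ℝ) ≤ t := by exact_mod_cast ht3
  have hd : (t : ℝ) ≤ d - 1 := by exact_mod_cast htd
  have hβ : 0 ≤ (t : ℝ) / β := by positivity
  have hα' : 0 ≤ (t : ℝ) / (α + 1) := by positivity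
  have hα : (t : ℝ) / (α + 1) ≤ t / α := by gcongr; linarith
  have disc (x : ℝ) : ((d : ℝ) - 2 - t / x - t / β) ^ 2 +
      4 * (2 * d + d * t / x + d * t / β - 2 * t) =
      (d + 2 + t / x + t / β) ^ 2 - 8 * t := by
    ring
  have key := sqrt_sq_sub_add_sub_le (u := d + 2 + t / (α + 1) + t / β)
    (v := d + 2 + t / α + t / β) (c := 8 * t)
    (by linarith) (by linarith) (by linarith) (by nlinarith [sq_nonneg ((t : ℝ) - 1)])
  simp only [disc]
  linarith
end

section
/- Let d and t be integers with 3 ≤ t ≤ d−1. The largest eigenvalue of the real 3×3 matrix with rows (−1, 1, 0), (d−t+1, d−2, d−t+1), (0, 1, −1) equals (d − 3 + √((d+3)² − 8t))/2; indeed its characteristic polynomial is (x+1)·(x² − (d−3)x − (3d − 2t)). -/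
open Polynomial

theorem stmt16 (d t : ℤ) (ht3 : 3 ≤ t) (htd : t ≤ d - 1) :
    let M : Matrix (Fin 3) (Fin 3) ℝ :=
      !![-1, 1, 0;
         (d : ℝ) - t + 1, (d : ℝ) - 2, (d : ℝ) - t + 1;
         0, 1, -1]
    M.charpoly = (X + C 1) * (X ^ 2 - C ((d : ℝ) - 3) * X - C (3 * (d : ℝ) - 2 * t)) ∧
      IsGreatest {x : ℝ | M.charpoly.IsRoot x}
        (((d : ℝ) - 3 + Real.sqrt (((d : ℝ) + 3) ^ 2 - 8 * t)) / 2) := by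
  intro M
  have hM : M.charpoly =
      (X + C 1) * (X ^ 2 - C ((d : ℝ) - 3) * X - C (3 * (d : ℝ) - 2 * t)) := by
    simp only [Matrix.charpoly, Matrix.det_fin_three, M]
    simp [show (C 2 : ℝ[X]) = 2 from rfl, show (C 3 : ℝ[X]) = 3 from rfl]
    ring
  refine ⟨hM, ?_⟩
  have ht : (3 : ℝ) ≤ t := by exact_mod_cast ht3
  have hd : (t : ℝ) + 1 ≤ d := by exact_mod_cast (by lia : t + 1 ≤ d)
  have hs := Real.sq_sqrt (show 0 ≤ ((d : ℝ) + 3) ^ 2 - 8 * t by nlinarith)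
  have hs0 := Real.sqrt_nonneg (((d : ℝ) + 3) ^ 2 - 8 * t)
  have hroot (x : ℝ) : M.charpoly.IsRoot x ↔
      x + 1 = 0 ∨ x ^ 2 - ((d : ℝ) - 3) * x - (3 * (d : ℝ) - 2 * t) = 0 := by
    rw [hM, IsRoot.def, eval_mul, mul_eq_zero]
    simp only [eval_add, eval_sub, eval_mul, eval_pow, eval_X, eval_C]
  constructor
  · rw [Set.mem_ofPred_eq, hroot]
    right
    linear_combination hs / 4
  · intro x hx
    rcases (hroot x).1 hx with h | h
    · linarith
    · have : 2 * x - ((d : ℝ) - 3) ≤ Real.sqrt (((d : ℝ) + 3) ^ 2 - 8 * t) :=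
        Real.le_sqrt_of_sq_le (by linarith)
      linarith
end

section
/- Let d and t be integers with 3 ≤ t ≤ d−2. The real 4×4 matrix with rows (d−t, t, 0, 0), (d+2−t, t−3, 1, 0), (0, 1, t−3, d+2−t), (0, 0, t, d−t) has eigenvalues exactly d, −2, (d − 4 + √((d+4)² − 8t))/2, and (d − 4 − √((d+4)² − 8t))/2 (each with multiplicity one). -/
open Polynomial

theorem charpoly_tridiagonal_four {R : Type*} [CommRing R] (a b : R) :
    (!![a - b, b, 0, 0;
        a + 2 - b, b - 3, 1, 0;
        0, 1, b - 3, a + 2 - b;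
        0, 0, b, a - b] : Matrix (Fin 4) (Fin 4) R).charpoly =
      (X - C a) * (X + 2) * (X ^ 2 - (C a - 4) * X + (2 * C b - 4 * C a)) := by
  have h2 : (C (2 : R) : R[X]) = 2 := rfl
  have h3 : (C (3 : R) : R[X]) = 3 := rfl
  rw [Matrix.charpoly, Matrix.det_succ_row_zero]
  simp [Fin.sum_univ_succ, Matrix.det_fin_three, Matrix.charmatrix_apply, Fin.succAbove,
    Matrix.diagonal_apply, h2, h3]
  ring

theorem stmt18 (d t : ℤ) (ht3 : 3 ≤ t) (htd : t ≤ d - 2) :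
    let M : Matrix (Fin 4) (Fin 4) ℝ :=
      !![(d : ℝ) - t, (t : ℝ), 0, 0;
         (d : ℝ) + 2 - t, (t : ℝ) - 3, 1, 0;
         0, 1, (t : ℝ) - 3, (d : ℝ) + 2 - t;
         0, 0, (t : ℝ), (d : ℝ) - t]
    let rP : ℝ := ((d : ℝ) - 4 + Real.sqrt (((d : ℝ) + 4) ^ 2 - 8 * t)) / 2
    let rM : ℝ := ((d : ℝ) - 4 - Real.sqrt (((d : ℝ) + 4) ^ 2 - 8 * t)) / 2
    M.charpoly = (X - C (d : ℝ)) * (X - C (-2 : ℝ)) * (X - C rP) * (X - C rM) ∧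
      ([(d : ℝ), -2, rP, rM] : List ℝ).Pairwise (· ≠ ·) := by
  intro M rP rM
  have ht : (3 : ℝ) ≤ t := by exact_mod_cast ht3
  have hd : (t : ℝ) ≤ d - 2 := by exact_mod_cast htd
  have hdisc : 0 < ((d : ℝ) + 4) ^ 2 - 8 * t := by nlinarith [sq_nonneg (d : ℝ)]
  have hsqrt := Real.sqrt_pos.2 hdisc
  have hsq := Real.sq_sqrt hdisc.le
  have hsum : rP + rM = d - 4 := by simp only [rP, rM]; ring
  have hprod : rP * rM = 2 * t - 4 * d := by simp only [rP, rM]; linarith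
  have hlt : rM < rP := by simp only [rP, rM]; linarith
  clear_value rP rM
  have eval_d : ((d : ℝ) - rP) * (d - rM) = 2 * t := by
    linear_combination hprod - (d : ℝ) * hsum
  have eval_neg_two : (-2 - rP) * (-2 - rM) = 2 * t - 2 * d - 4 := by
    linear_combination hprod + 2 * hsum
  refine ⟨?_, ?_⟩
  · have hsumC : C rP + C rM = C (d : ℝ) - 4 := by
      rw [← C_add, hsum, C_sub]; rfl
    have hprodC : C rP * C rM = 2 * C (t : ℝ) - 4 * C (d : ℝ) := by
      rw [← C_mul, hprod, C_sub, C_mul, C_mul]; rfl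
    have h2 : (C (2 : ℝ) : ℝ[X]) = 2 := rfl
    rw [charpoly_tridiagonal_four, ← hsumC, ← hprodC, C_neg, h2]
    ring
  · simp only [List.pairwise_cons, List.mem_cons, List.not_mem_nil, or_false, forall_eq_or_imp,
      forall_eq, IsEmpty.forall_iff, implies_true, List.Pairwise.nil, and_true]
    refine ⟨⟨?_, ?_, ?_⟩, ⟨?_, ?_⟩, hlt.ne'⟩
    · linarith
    · rintro h
      rw [h, sub_self, zero_mul] at eval_d
      linarith
    · rintro h
      rw [h, sub_self, mul_zero] at eval_d
      linarith
    · rintro h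
      rw [← h, sub_self, zero_mul] at eval_neg_two
      linarith
    · rintro h
      rw [← h, sub_self, mul_zero] at eval_neg_two
      linarith
end
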